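/- arXiv:2512.12204 — 3 statements merged into one kernel-verified Lean document; each statement's English description precedes it below -/
import Mathlib

section
/- Let N > 1 be a natural number, let d > 0 and λ > 0 be real with λ ≤ 2Nd, and let θ₀, θ₁ ∈ [0, 2π). Then there exist rotation angles β, γ ∈ [0, 2π) such that ∑_{n=0}^{N-1} exp(i·(2π/λ)·n·d·cos β·(cos(γ+θ₁) − cos(γ+θ₀))) = 0 if and only if |θ₀ − θ₁| ∈ [2·arcsin(λ/(2Nd)), 2π − 2·arcsin(λ/(2Nd))]. -/
theorem exists_int_of_sum_exp_eq_zero {N : ℕ} {t : ℝ}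
    (h : ∑ n ∈ Finset.range N, Complex.exp (Complex.I * t) ^ n = 0) (hN : 0 < N) :
    ∃ k : ℤ, k ≠ 0 ∧ N * t = k * (2 * Real.pi) := by
  have hpow : Complex.exp (Complex.I * t) ^ N = 1 := by
    have := geom_sum_mul (Complex.exp (Complex.I * t)) N
    rw [h, zero_mul] at this
    exact (sub_eq_zero.mp this.symm)
  rw [← Complex.exp_nat_mul, Complex.exp_eq_one_iff] at hpow
  obtain ⟨k, hk⟩ := hpow
  have hk' : N * t = k * (2 * Real.pi) := by
    have hc : (N * t : ℂ) = k * (2 * Real.pi) := by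
      apply mul_right_cancel₀ Complex.I_ne_zero
      linear_combination hk
    exact_mod_cast hc
  refine ⟨k, ?_, hk'⟩
  rintro rfl
  have ht : t = 0 := by
    have : (N : ℝ) ≠ 0 := by positivity
    simpa [this] using hk'
  subst ht
  simp at h
  omega

theorem sum_exp_two_pi_div_eq_zero {N : ℕ} (hN : 1 < N) :
    ∑ n ∈ Finset.range N,
      Complex.exp (Complex.I * ((2 * Real.pi / N : ℝ) : ℂ)) ^ n = 0 := by
  have h := (Complex.isPrimitiveRoot_exp N (by omega)).geom_sum_eq_zero hN
  convert h using 4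
  push_cast
  ring

theorem le_sin_half_iff {a x : ℝ} (ha : 0 ≤ a) (ha1 : a ≤ 1) (hx : 0 ≤ x)
    (hx2 : x < 2 * Real.pi) :
    a ≤ Real.sin (x / 2) ↔
      x ∈ Set.Icc (2 * Real.arcsin a) (2 * Real.pi - 2 * Real.arcsin a) := by
  have h0 := Real.arcsin_nonneg.mpr ha
  rcases le_total x Real.pi with h | h
  · rw [← Real.arcsin_le_iff_le_sin ⟨by linarith, ha1⟩ ⟨by linarith, by linarith⟩, Set.mem_Icc]
    have := Real.arcsin_le_pi_div_two a
    constructor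
    · intro h; constructor <;> linarith
    · intro h; linarith [h.1]
  · rw [← Real.sin_pi_sub,
      ← Real.arcsin_le_iff_le_sin ⟨by linarith, ha1⟩ ⟨by linarith, by linarith⟩, Set.mem_Icc]
    have := Real.arcsin_le_pi_div_two a
    constructor
    · intro h; constructor <;> linarith
    · intro h; linarith [h.2]

theorem abs_sin_half_sub {x y : ℝ} (h : |x - y| ≤ 2 * Real.pi) :
    |Real.sin ((y - x) / 2)| = Real.sin (|x - y| / 2) := by
  have h' : |(y - x) / 2| = |x - y| / 2 := by
    rw [abs_div, abs_sub_comm, abs_of_pos (two_pos : (0 : ℝ) < 2)]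
  rw [Real.abs_sin_eq_sin_abs_of_abs_le_pi (by rw [h']; linarith), h']

/-- Proposition 1: for an N-element ULA with spacing d and wavelength lam ≤ 2Nd,
rotation angles β, γ achieving steering-vector orthogonality between directions
θ₀ and θ₁ exist iff the angular separation lies in
[2 arcsin(lam/(2Nd)), 2π − 2 arcsin(lam/(2Nd))]. -/
theorem stmt_0 (N : ℕ) (hN : 1 < N) (d lam : ℝ) (hd : 0 < d) (hlam : 0 < lam)
    (hle : lam ≤ 2 * N * d)
    (θ₀ θ₁ : ℝ) (hθ₀ : θ₀ ∈ Set.Ico 0 (2 * Real.pi)) (hθ₁ : θ₁ ∈ Set.Ico 0 (2 * Real.pi)) :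
    (∃ β γ : ℝ, β ∈ Set.Ico 0 (2 * Real.pi) ∧ γ ∈ Set.Ico 0 (2 * Real.pi) ∧
      ∑ n ∈ Finset.range N,
        Complex.exp (Complex.I *
          ((2 * Real.pi / lam * n * d * Real.cos β *
            (Real.cos (γ + θ₁) - Real.cos (γ + θ₀)) : ℝ) : ℂ)) = 0)
    ↔ |θ₀ - θ₁| ∈
        Set.Icc (2 * Real.arcsin (lam / (2 * N * d)))
          (2 * Real.pi - 2 * Real.arcsin (lam / (2 * N * d))) := by
  have hNpos : (0 : ℝ) < N := by exact_mod_cast (by omega : 0 < N)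
  have hpi := Real.pi_pos
  have hapos : 0 < lam / (2 * N * d) := by positivity
  have hdiff : |θ₀ - θ₁| < 2 * Real.pi := by
    rw [abs_lt]; constructor <;> linarith [hθ₀.1, hθ₀.2, hθ₁.1, hθ₁.2]
  rw [← le_sin_half_iff hapos.le (by rw [div_le_one (by positivity)]; exact hle)
    (abs_nonneg _) hdiff, ← abs_sin_half_sub hdiff.le]
  set s := Real.sin ((θ₁ - θ₀) / 2) with hs
  have hcos (γ : ℝ) : Real.cos (γ + θ₁) - Real.cos (γ + θ₀) =
      -2 * Real.sin (γ + (θ₀ + θ₁) / 2) * s := by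
    rw [Real.cos_sub_cos, hs]
    ring_nf
  have hsum (β γ : ℝ) : ∑ n ∈ Finset.range N,
        Complex.exp (Complex.I *
          ((2 * Real.pi / lam * n * d * Real.cos β *
            (Real.cos (γ + θ₁) - Real.cos (γ + θ₀)) : ℝ) : ℂ)) =
      ∑ n ∈ Finset.range N, Complex.exp (Complex.I *
        ((2 * Real.pi / lam * d * Real.cos β *
            (-2 * Real.sin (γ + (θ₀ + θ₁) / 2) * s) : ℝ) : ℂ)) ^ n := by
    refine Finset.sum_congr rfl fun n _ => ?_
    rw [← Complex.exp_nat_mul, hcos]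
    push_cast
    ring_nf
  simp only [hsum]
  constructor
  · rintro ⟨β, γ, -, -, h⟩
    obtain ⟨k, hk0, hk⟩ := exists_int_of_sum_exp_eq_zero h (by omega)
    have hk1 : (1 : ℝ) ≤ |(k : ℝ)| := by exact_mod_cast Int.one_le_abs hk0
    have hbound : |Real.cos β * Real.sin (γ + (θ₀ + θ₁) / 2)| ≤ 1 := by
      rw [abs_mul]
      exact mul_le_one₀ (Real.abs_cos_le_one _) (abs_nonneg _) (Real.abs_sin_le_one _)
    generalize Real.sin (γ + (θ₀ + θ₁) / 2) = u at hk hbound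
    have hk2 : (k : ℝ) * lam = -(2 * N * d) * ((Real.cos β * u) * s) := by
      field_simp at hk
      linear_combination -hk
    have hk3 := congrArg abs hk2
    rw [abs_mul, abs_mul, abs_mul _ s, abs_neg, abs_of_pos hlam,
      abs_of_pos (by positivity : 0 < 2 * N * d)] at hk3
    rw [div_le_iff₀' (by positivity)]
    calc lam ≤ |(k : ℝ)| * lam := le_mul_of_one_le_left hlam.le hk1
      _ = _ := hk3
      _ ≤ 2 * N * d * |s| := by
        gcongr
        exact mul_le_of_le_one_left (abs_nonneg _) hbound
  · intro h
    have hs0 : s ≠ 0 := abs_pos.mp (hapos.trans_le h)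
    have hx : |lam / (2 * N * d) / s| ≤ 1 := by
      rw [abs_div, abs_of_pos hapos]
      exact div_le_one_of_le₀ h (abs_nonneg _)
    rw [abs_le] at hx
    have h2pi : 0 < 2 * Real.pi := by positivity
    refine ⟨Real.arccos (lam / (2 * N * d) / s),
      toIcoMod h2pi 0 (-(Real.pi / 2) - (θ₀ + θ₁) / 2),
      ⟨Real.arccos_nonneg _, by linarith [Real.arccos_le_pi (lam / (2 * N * d) / s)]⟩,
      by simpa using toIcoMod_mem_Ico h2pi 0 (-(Real.pi / 2) - (θ₀ + θ₁) / 2), ?_⟩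
    have hsin : Real.sin (toIcoMod h2pi 0 (-(Real.pi / 2) - (θ₀ + θ₁) / 2) + (θ₀ + θ₁) / 2)
        = -1 := by
      rw [toIcoMod, zsmul_eq_mul, sub_right_comm, sub_add_cancel, Real.sin_sub_int_mul_two_pi,
        Real.sin_neg, Real.sin_pi_div_two]
    have hphase : 2 * Real.pi / lam * d * (lam / (2 * N * d) / s) * (-2 * -1 * s) =
        2 * Real.pi / N := by
      field_simp
    rw [hsin, Real.cos_arccos hx.1 hx.2, hphase, sum_exp_two_pi_div_eq_zero hN]
end

section
/- Let N > 1 be a natural number, d > 0 and λ > 0 real, and θ₀, θ₁, β, γ real with θ₀ ≠ θ₁. Then ∑_{n=0}^{N-1} exp(i·(2π/λ)·n·d·cos β·(cos(γ+θ₁) − cos(γ+θ₀))) = 0 if and only if there exists an integer m not divisible by N such that 2·cos β·sin(γ + (θ₀+θ₁)/2)·sin((θ₀−θ₁)/2) = mλ/(Nd). -/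
open Real Complex Finset

/-- In a field, a nonempty geometric sum vanishes iff its ratio is a nontrivial root of unity. -/
theorem geom_sum_eq_zero_iff_pow_eq_one {K : Type*} [Field K] [CharZero K] {N : ℕ} (hN : N ≠ 0)
    (z : K) : ∑ n ∈ Finset.range N, z ^ n = 0 ↔ z ^ N = 1 ∧ z ≠ 1 := by
  by_cases hz : z = 1
  · simp [hz, hN]
  · rw [geom_sum_eq hz, div_eq_zero_iff, sub_eq_zero, sub_eq_zero]
    simp [hz]

theorem exp_ofReal_mul_two_pi_mul_I_eq_one_iff (t : ℝ) :
    Complex.exp (t * (2 * Real.pi * Complex.I)) = 1 ↔ ∃ k : ℤ, t = k := by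
  rw [Complex.exp_eq_one_iff]
  refine exists_congr fun k => ?_
  rw [mul_left_inj' Complex.two_pi_I_ne_zero]
  norm_cast

/-- The zeros of the Dirichlet kernel. -/
theorem sum_exp_mul_two_pi_mul_I_eq_zero_iff {N : ℕ} (hN : N ≠ 0) (t : ℝ) :
    ∑ n ∈ Finset.range N, Complex.exp (t * (2 * Real.pi * Complex.I)) ^ n = 0 ↔
      ∃ m : ℤ, ¬ ((N : ℤ) ∣ m) ∧ N * t = m := by
  have hN' : (N : ℝ) ≠ 0 := Nat.cast_ne_zero.mpr hN
  have hpow : Complex.exp (t * (2 * Real.pi * Complex.I)) ^ N =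
      Complex.exp (((N * t : ℝ) : ℂ) * (2 * Real.pi * Complex.I)) := by
    rw [← Complex.exp_nat_mul]
    push_cast
    ring_nf
  rw [geom_sum_eq_zero_iff_pow_eq_one hN, hpow, exp_ofReal_mul_two_pi_mul_I_eq_one_iff, Ne,
    exp_ofReal_mul_two_pi_mul_I_eq_one_iff, ← exists_and_right]
  refine exists_congr fun m => ?_
  rw [and_comm]
  refine and_congr_left fun hm => not_congr (exists_congr fun k => ?_)
  rw [← mul_right_inj' hN', hm]
  norm_cast

/-- Characterization (paper's eqs. (27)–(29)): for fixed rotation angles β, γ,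
the steering vectors at θ₀ and θ₁ are orthogonal iff
2 cos β · sin(γ + (θ₀+θ₁)/2) · sin((θ₀−θ₁)/2) = mλ/(Nd) for some integer m
not divisible by N. -/
theorem stmt_2 (N : ℕ) (hN : 1 < N) (d lam : ℝ) (hd : 0 < d) (hlam : 0 < lam)
    (θ₀ θ₁ β γ : ℝ) (hne : θ₀ ≠ θ₁) :
    (∑ n ∈ Finset.range N,
        Complex.exp (Complex.I *
          ((2 * Real.pi / lam * n * d * Real.cos β *
            (Real.cos (γ + θ₁) - Real.cos (γ + θ₀)) : ℝ) : ℂ)) = 0)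
    ↔ ∃ m : ℤ, ¬ ((N : ℤ) ∣ m) ∧
        2 * Real.cos β * Real.sin (γ + (θ₀ + θ₁) / 2) * Real.sin ((θ₀ - θ₁) / 2)
          = m * lam / (N * d) := by
  have hcos : Real.cos (γ + θ₁) - Real.cos (γ + θ₀) =
      2 * Real.sin (γ + (θ₀ + θ₁) / 2) * Real.sin ((θ₀ - θ₁) / 2) := by
    rw [Real.cos_sub_cos, show (γ + θ₁ + (γ + θ₀)) / 2 = γ + (θ₀ + θ₁) / 2 by ring,
      show (γ + θ₁ - (γ + θ₀)) / 2 = -((θ₀ - θ₁) / 2) by ring, Real.sin_neg]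
    ring
  have hN' : (N : ℝ) ≠ 0 := by positivity
  rw [hcos]
  set a := Real.sin (γ + (θ₀ + θ₁) / 2)
  set b := Real.sin ((θ₀ - θ₁) / 2)
  rw [show (∑ n ∈ Finset.range N, Complex.exp (Complex.I *
        ((2 * Real.pi / lam * n * d * Real.cos β * (2 * a * b) : ℝ) : ℂ))) =
      ∑ n ∈ Finset.range N, Complex.exp
        (((d / lam * (2 * Real.cos β * a * b) : ℝ) : ℂ) * (2 * Real.pi * Complex.I)) ^ n from
    Finset.sum_congr rfl fun n _ => by
      rw [← Complex.exp_nat_mul]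
      push_cast
      ring_nf,
    sum_exp_mul_two_pi_mul_I_eq_zero_iff (by omega)]
  refine exists_congr fun m => and_congr_right fun _ => ?_
  rw [eq_div_iff (by positivity), ← mul_left_inj' hlam.ne']
  field_simp
end

section
/- Let N > 1 be a natural number, d > 0 and λ > 0 real, θ₀ real, and Δ ∈ (0, π) with λ ≤ N·d·|sin Δ|. Set θ₁ = θ₀ − Δ and θ₂ = θ₀ + Δ. Then there exist real angles α, β, γ such that the effective boresight cosine satisfies −sin α·sin β·cos(γ+θ₀) + cos α·sin(γ+θ₀) = 1 and, for both k = 1 and k = 2, ∑_{n=0}^{N-1} exp(i·(2π/λ)·n·d·cos β·(cos(γ+θ_k) − cos(γ+θ₀))) = 0. -/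
open Real Complex Finset

theorem sum_exp_eq_zero_of_isPrimitiveRoot {N : ℕ} (hN : 1 < N) {z : ℂ}
    (hz : IsPrimitiveRoot (Complex.exp z) N) {f : ℕ → ℂ} (hf : ∀ n, f n = n * z) :
    ∑ n ∈ Finset.range N, Complex.exp (f n) = 0 := by
  simpa only [hf, Complex.exp_nat_mul] using hz.geom_sum_eq_zero hN

/-- Paper's claim for K = 2 interference directions symmetric about the desired
direction θ₀: if λ ≤ Nd·|sin Δ|, there exist rotation angles α, β, γ achieving
full element gain at θ₀ and steering-vector orthogonality to both
θ₁ = θ₀ − Δ and θ₂ = θ₀ + Δ. -/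
theorem stmt_17 (N : ℕ) (hN : 1 < N) (d lam : ℝ) (hd : 0 < d) (hlam : 0 < lam)
    (θ₀ Δ : ℝ) (hΔ : Δ ∈ Set.Ioo 0 Real.pi) (hle : lam ≤ N * d * |Real.sin Δ|)
    (θ₁ θ₂ : ℝ) (hθ₁ : θ₁ = θ₀ - Δ) (hθ₂ : θ₂ = θ₀ + Δ) :
    ∃ α β γ : ℝ,
      (-Real.sin α * Real.sin β * Real.cos (γ + θ₀) +
        Real.cos α * Real.sin (γ + θ₀) = 1) ∧
      (∀ θk, θk = θ₁ ∨ θk = θ₂ →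
        ∑ n ∈ Finset.range N,
          Complex.exp (Complex.I *
            ((2 * Real.pi / lam * n * d * Real.cos β *
              (Real.cos (γ + θk) - Real.cos (γ + θ₀)) : ℝ) : ℂ)) = 0) := by
  have hs : 0 < Real.sin Δ := Real.sin_pos_of_pos_of_lt_pi hΔ.1 hΔ.2
  rw [abs_of_pos hs] at hle
  have hN0 : (0 : ℝ) < N := by exact_mod_cast hN.trans' one_pos
  have hp : 0 < N * d * Real.sin Δ := by positivity
  have hroot := Complex.isPrimitiveRoot_exp N (by lia)
  have hcos : Real.cos (Real.arccos (lam / (N * d * Real.sin Δ))) =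
      lam / (N * d * Real.sin Δ) :=
    Real.cos_arccos (by linarith [div_pos hlam hp]) ((div_le_one hp).2 hle)
  refine ⟨0, Real.arccos (lam / (N * d * Real.sin Δ)), Real.pi / 2 - θ₀, by simp, ?_⟩
  rintro θk (rfl | rfl)
  · refine sum_exp_eq_zero_of_isPrimitiveRoot hN hroot fun n => ?_
    have hphase : 2 * Real.pi / lam * n * d * (lam / (N * d * Real.sin Δ)) * Real.sin Δ =
        n * (2 * Real.pi / N) := by
      field_simp
    have hangle : Real.pi / 2 - θ₀ + θk = Real.pi / 2 - Δ := by rw [hθ₁]; ring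
    rw [hcos, hangle, Real.cos_pi_div_two_sub, sub_add_cancel, Real.cos_pi_div_two, sub_zero,
      hphase]
    push_cast
    ring
  · have hroot' := hroot.inv
    rw [← Complex.exp_neg] at hroot'
    refine sum_exp_eq_zero_of_isPrimitiveRoot hN hroot' fun n => ?_
    have hphase : 2 * Real.pi / lam * n * d * (lam / (N * d * Real.sin Δ)) * -Real.sin Δ =
        -(n * (2 * Real.pi / N)) := by
      field_simp
    have hangle : Real.pi / 2 - θ₀ + θk = Δ + Real.pi / 2 := by rw [hθ₂]; ring
    rw [hcos, hangle, Real.cos_add_pi_div_two, sub_add_cancel, Real.cos_pi_div_two, sub_zero,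
      hphase]
    push_cast
    ring
end
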